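/- arXiv:2307.16862 — 2 statements merged into one kernel-verified Lean document; each statement's English description precedes it below -/
import Mathlib

section
/- For every invertible A ∈ GL(n, ℝ), the matrix A ⊗ₛ A ∈ ℝ^{n̄ × n̄} is invertible and (A ⊗ₛ A)⁻¹ = A⁻¹ ⊗ₛ A⁻¹. -/
open Matrix

noncomputable section

/-- `n̄ = n(n+1)/2`, the dimension of the space of symmetric `n × n` matrices. -/
def triDim (n : ℕ) : ℕ := n * (n + 1) / 2

/-- The (0-based) row/column pair `(r(j), c(j))` of the `j`-th position in the
lexicographic (left-to-right, top-to-bottom) enumeration of the on-or-above-diagonal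
positions of an `n × n` matrix. -/
def rcPair : ℕ → ℕ → ℕ × ℕ
  | 0, _ => (0, 0)
  | (m + 1), j =>
      if j < m + 1 then (0, j)
      else ((rcPair m (j - (m + 1))).1 + 1, (rcPair m (j - (m + 1))).2 + 1)

/-- The orthonormal basis `E_j` of the space of symmetric `n × n` matrices:
`E_j = e_{r(j)} e_{c(j)}ᵀ` if `r(j) = c(j)`, and
`E_j = (√2/2) (e_{r(j)} e_{c(j)}ᵀ + e_{c(j)} e_{r(j)}ᵀ)` if `r(j) < c(j)`. -/
def symBasis (n : ℕ) (j : Fin (triDim n)) : Matrix (Fin n) (Fin n) ℝ :=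
  if (rcPair n j).1 = (rcPair n j).2 then
    Matrix.of fun a b : Fin n =>
      if (a : ℕ) = (rcPair n j).1 ∧ (b : ℕ) = (rcPair n j).2 then (1 : ℝ) else 0
  else
    Matrix.of fun a b : Fin n =>
      if ((a : ℕ) = (rcPair n j).1 ∧ (b : ℕ) = (rcPair n j).2) ∨
          ((a : ℕ) = (rcPair n j).2 ∧ (b : ℕ) = (rcPair n j).1) then
        Real.sqrt 2 / 2
      else 0

/-- Column-stacking vectorization `vec : ℝ^{m×n} → ℝ^{nm}`: `vec(A)_{j·m + i} = A_{i,j}`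
(0-based), realized through `finProdFinEquiv (j, i) = j * m + i`. -/
def mvec {m n : ℕ} (A : Matrix (Fin m) (Fin n) ℝ) : Fin (n * m) → ℝ :=
  fun k => A (finProdFinEquiv.symm k).2 (finProdFinEquiv.symm k).1

/-- The matrix `W_n ∈ ℝ^{n̄ × n²}` whose `j`-th row is `vec(E_j)ᵀ`. -/
def Wmat (n : ℕ) : Matrix (Fin (triDim n)) (Fin (n * n)) ℝ :=
  Matrix.of fun j k => mvec (symBasis n j) k

/-- The Kronecker product on `Fin`-indexed matrices, with the standard flattening
`(A ⊗ B)_{(i·p + k, j·q + l)} = A_{i,j} B_{k,l}`. -/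
def kron {m n p q : ℕ} (A : Matrix (Fin m) (Fin n) ℝ) (B : Matrix (Fin p) (Fin q) ℝ) :
    Matrix (Fin (m * p)) (Fin (n * q)) ℝ :=
  Matrix.reindex finProdFinEquiv finProdFinEquiv (Matrix.kroneckerMap (· * ·) A B)

/-- The symmetric Kronecker product `A ⊗ₛ B = W_m (A ⊗ B) W_nᵀ ∈ ℝ^{m̄ × n̄}`
of rectangular matrices `A, B ∈ ℝ^{m×n}`. -/
def skron {m n : ℕ} (A B : Matrix (Fin m) (Fin n) ℝ) :
    Matrix (Fin (triDim m)) (Fin (triDim n)) ℝ :=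
  Wmat m * kron A B * (Wmat n)ᵀ

/-- The Frobenius inner product `⟨A, B⟩_F = trace(Aᵀ B)`. -/
def frobInner {m n : ℕ} (A B : Matrix (Fin m) (Fin n) ℝ) : ℝ :=
  (Aᵀ * B).trace

/-- Symmetric vectorization `svec(P)_j = ⟨P, E_j⟩_F`. -/
def svec {n : ℕ} (P : Matrix (Fin n) (Fin n) ℝ) : Fin (triDim n) → ℝ :=
  fun j => frobInner P (symBasis n j)

/-- The symmetric part `π(A) = (A + Aᵀ)/2`. -/
def symPart {n : ℕ} (A : Matrix (Fin n) (Fin n) ℝ) : Matrix (Fin n) (Fin n) ℝ :=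
  (1 / 2 : ℝ) • (A + Aᵀ)

/-- The symmetric Kronecker sum `A ⊕ₛ B = A ⊗ₛ I + I ⊗ₛ B`. -/
def skronSum {n : ℕ} (A B : Matrix (Fin n) (Fin n) ℝ) :
    Matrix (Fin (triDim n)) (Fin (triDim n)) ℝ :=
  skron A 1 + skron 1 B

/-- A vector `x ∈ ℝⁿ` regarded as an `n × 1` matrix. -/
def colVec {n : ℕ} (x : Fin n → ℝ) : Matrix (Fin n) (Fin 1) ℝ :=
  Matrix.of fun i _ => x i

theorem triDim_succ (m : ℕ) : triDim (m + 1) = (m + 1) + triDim m := by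
  unfold triDim
  rw [show (m + 1) * (m + 1 + 1) = m * (m + 1) + (m + 1) * 2 by ring,
    Nat.add_mul_div_right _ _ (by norm_num), Nat.add_comm]

theorem rcPair_lt {n j : ℕ} (hj : j < triDim n) :
    (rcPair n j).1 ≤ (rcPair n j).2 ∧ (rcPair n j).2 < n := by
  induction n generalizing j with
  | zero => simp [triDim] at hj
  | succ m ih =>
    rw [triDim_succ] at hj
    rw [rcPair]
    split_ifs with h
    · simpa using h
    · have := @ih (j - (m + 1)) (by omega)
      simpa using this

theorem rcPair_inj {n j k : ℕ} (hj : j < triDim n) (hk : k < triDim n)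
    (h : rcPair n j = rcPair n k) : j = k := by
  induction n generalizing j k with
  | zero => simp [triDim] at hj
  | succ m ih =>
    rw [triDim_succ] at hj hk
    simp only [rcPair] at h
    split_ifs at h with h1 h2 h2
    · simpa using h
    · simp at h
    · simp at h
    · have := @ih (j - (m + 1)) (k - (m + 1)) (by omega) (by omega)
        (by simpa [Prod.ext_iff] using h)
      omega

theorem exists_rcPair {n r c : ℕ} (hrc : r ≤ c) (hc : c < n) :
    ∃ j < triDim n, rcPair n j = (r, c) := by
  induction n generalizing r c with
  | zero => omega
  | succ m ih =>
    rcases r with _ | r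
    · exact ⟨c, by rw [triDim_succ]; omega, by simp [rcPair, hc]⟩
    · obtain ⟨c, rfl⟩ : ∃ d, c = d + 1 := ⟨c - 1, by omega⟩
      obtain ⟨j, hj, h⟩ := @ih r c (by omega) (by omega)
      exact ⟨j + (m + 1), by rw [triDim_succ]; omega, by
        rw [rcPair, if_neg (by omega), Nat.add_sub_cancel, h]⟩

/-- The entries of `symBasis` through the sorted pair of indices. -/
theorem symBasis_apply {n : ℕ} (j : Fin (triDim n)) (a b : Fin n) :
    symBasis n j a b = if rcPair n j = (min (a : ℕ) b, max (a : ℕ) b) then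
      (if a = b then 1 else Real.sqrt 2 / 2) else 0 := by
  have h := (rcPair_lt j.2).1
  unfold symBasis
  generalize rcPair n j = p at *
  obtain ⟨r, c⟩ := p
  simp only [Prod.mk.injEq, Fin.ext_iff] at *
  split_ifs <;> simp only [of_apply] <;> split_ifs <;> first | rfl | omega

theorem sqrt_two_half_mul_self : Real.sqrt 2 / 2 * (Real.sqrt 2 / 2) = 1 / 2 := by
  have := Real.mul_self_sqrt (show (0 : ℝ) ≤ 2 by norm_num)
  linarith

theorem sum_symBasis_mul {n : ℕ} (a b c d : Fin n) :
    ∑ j, symBasis n j a b * symBasis n j c d =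
      1 / 2 * ((if a = c ∧ b = d then 1 else 0) + (if b = c ∧ a = d then 1 else 0)) := by
  obtain ⟨j, hj, h⟩ := exists_rcPair (n := n) (min_le_max (a := (a : ℕ)) (b := b))
    (max_lt a.2 b.2)
  rw [Finset.sum_eq_single (⟨j, hj⟩ : Fin (triDim n))]
  · rw [symBasis_apply, symBasis_apply]
    simp only [h, Prod.mk.injEq, Fin.ext_iff]
    split_ifs <;> first | omega | norm_num [sqrt_two_half_mul_self]
  · intro k _ hk
    rw [symBasis_apply, if_neg, zero_mul]
    intro hk'
    exact hk (Fin.ext (rcPair_inj k.2 hj (hk'.trans h.symm)))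
  · simp

theorem sum_symBasis_mul_symBasis {n : ℕ} (j k : Fin (triDim n)) :
    ∑ p : Fin n × Fin n, symBasis n j p.1 p.2 * symBasis n k p.1 p.2 =
      if j = k then 1 else 0 := by
  split_ifs with hjk
  · subst hjk
    obtain ⟨h1, h2⟩ := rcPair_lt j.2
    set r : Fin n := ⟨(rcPair n j).1, h1.trans_lt h2⟩ with hr
    set c : Fin n := ⟨(rcPair n j).2, h2⟩ with hc
    have key (p : Fin n × Fin n) : symBasis n j p.1 p.2 * symBasis n j p.1 p.2 =
        1 / 2 * ((if p = (r, c) then 1 else 0) + (if p = (c, r) then 1 else 0)) := by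
      rw [symBasis_apply]
      simp only [hr, hc, Prod.ext_iff, Fin.ext_iff]
      split_ifs <;> first | omega | norm_num [sqrt_two_half_mul_self]
    simp only [key, ← Finset.mul_sum, Finset.sum_add_distrib, Finset.sum_ite_eq',
      Finset.mem_univ, if_true]
    norm_num
  · refine Finset.sum_eq_zero fun p _ => ?_
    rw [symBasis_apply, symBasis_apply]
    by_cases h1 : rcPair n j = (min (p.1 : ℕ) p.2, max (p.1 : ℕ) p.2)
    · rw [if_neg (c := rcPair n k = _), mul_zero]
      exact fun h2 => hjk (Fin.ext (rcPair_inj j.2 k.2 (h1.trans h2.symm)))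
    · rw [if_neg h1, zero_mul]

theorem Wmat_mul_transpose (n : ℕ) : Wmat n * (Wmat n)ᵀ = 1 := by
  ext j k
  rw [mul_apply, one_apply, ← sum_symBasis_mul_symBasis,
    ← (finProdFinEquiv.symm.trans (Equiv.prodComm (Fin n) (Fin n))).sum_comp]
  rfl

/-- `Wᵀ W` is the symmetrizer, the average of the identity and the swap. -/
theorem Wmat_transpose_mul (n : ℕ) : (Wmat n)ᵀ * Wmat n =
    reindex finProdFinEquiv finProdFinEquiv ((1 / 2 : ℝ) •
      ((1 : Matrix (Fin n × Fin n) (Fin n × Fin n) ℝ) +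
        (1 : Matrix (Fin n × Fin n) (Fin n × Fin n) ℝ).submatrix Prod.swap id)) := by
  ext p q
  obtain ⟨⟨b, a⟩, rfl⟩ := finProdFinEquiv.surjective p
  obtain ⟨⟨d, c⟩, rfl⟩ := finProdFinEquiv.surjective q
  rw [mul_apply]
  simp only [Wmat, mvec, transpose_apply, of_apply, Equiv.symm_apply_apply, sum_symBasis_mul,
    reindex_apply, submatrix_apply, Matrix.smul_apply, Matrix.add_apply, one_apply, smul_eq_mul, Prod.swap,
    Prod.mk.injEq, id]
  simp only [and_comm]

theorem kron_mul {n : ℕ} (A B C D : Matrix (Fin n) (Fin n) ℝ) :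
    kron A B * kron C D = kron (A * C) (B * D) := by
  simp only [kron, reindex_apply, submatrix_mul_equiv]
  rw [mul_kronecker_mul]

theorem kron_one (n : ℕ) :
    kron (1 : Matrix (Fin n) (Fin n) ℝ) (1 : Matrix (Fin n) (Fin n) ℝ) = 1 := by
  simp only [kron, reindex_apply]
  rw [one_kronecker_one, submatrix_one_equiv]

theorem Wmat_transpose_mul_comm_kron {n : ℕ} (A : Matrix (Fin n) (Fin n) ℝ) :
    Commute ((Wmat n)ᵀ * Wmat n) (kron A A) := by
  rw [Wmat_transpose_mul, Commute, SemiconjBy]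
  simp only [kron, reindex_apply, submatrix_mul_equiv]
  congr 1
  simp only [Matrix.smul_mul, Matrix.mul_smul, Matrix.add_mul, Matrix.mul_add, Matrix.one_mul,
    Matrix.mul_one]
  congr 2
  ext ⟨a, b⟩ ⟨c, d⟩
  simp [mul_apply, one_apply, Prod.swap, Fintype.sum_prod_type, ite_and, Prod.ext_iff, mul_comm]

/-- The symmetric Kronecker square is multiplicative. -/
theorem skron_mul_skron {n : ℕ} (A B : Matrix (Fin n) (Fin n) ℝ) :
    skron A A * skron B B = skron (A * B) (A * B) := by
  calc skron A A * skron B B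
      = Wmat n * (kron A A * ((Wmat n)ᵀ * Wmat n)) * kron B B * (Wmat n)ᵀ := by
        simp only [skron, Matrix.mul_assoc]
    _ = (Wmat n * (Wmat n)ᵀ) * (Wmat n * (kron A A * kron B B) * (Wmat n)ᵀ) := by
        rw [← (Wmat_transpose_mul_comm_kron A).eq]
        simp only [Matrix.mul_assoc]
    _ = skron (A * B) (A * B) := by
        rw [Wmat_mul_transpose, Matrix.one_mul, kron_mul, skron]

theorem skron_one (n : ℕ) :
    skron (1 : Matrix (Fin n) (Fin n) ℝ) (1 : Matrix (Fin n) (Fin n) ℝ) = 1 := by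
  rw [skron, kron_one, Matrix.mul_one, Wmat_mul_transpose]

/-- for invertible `A`, `A ⊗ₛ A` is invertible with
`(A ⊗ₛ A)⁻¹ = A⁻¹ ⊗ₛ A⁻¹`. -/
theorem skron_inv (n : ℕ) (A : Matrix (Fin n) (Fin n) ℝ) (hA : IsUnit A) :
    IsUnit (skron A A) ∧ (skron A A)⁻¹ = skron A⁻¹ A⁻¹ := by
  have hmul : skron A A * skron A⁻¹ A⁻¹ = 1 := by
    rw [skron_mul_skron, mul_nonsing_inv A ((isUnit_iff_isUnit_det A).mp hA), skron_one]
  exact ⟨IsUnit.of_mul_eq_one _ hmul, inv_eq_right_inv hmul⟩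
end
end

section
/- Vanishing of the symmetric Kronecker product: for A, B ∈ ℝ^{m×n}, A ⊗ₛ B = 0 if and only if A = 0 or B = 0. -/
open Matrix

noncomputable section

theorem exists_rcPair_eq (n : ℕ) : ∀ p q : ℕ, p ≤ q → q < n →
    ∃ j : ℕ, j < triDim n ∧ rcPair n j = (p, q) := by
  induction n with
  | zero => intro p q _ h; omega
  | succ n ih =>
    have hdim : triDim (n + 1) = triDim n + (n + 1) := by
      have : (n + 1) * (n + 1 + 1) = n * (n + 1) + (n + 1) * 2 := by ring
      unfold triDim
      omega
    intro p q hpq hq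
    cases p with
    | zero => exact ⟨q, by omega, by simp [rcPair, hq]⟩
    | succ p =>
      obtain ⟨q, rfl⟩ : ∃ r, q = r + 1 := ⟨q - 1, by omega⟩
      obtain ⟨j, hj, hr⟩ := ih p q (by omega) (by omega)
      exact ⟨j + (n + 1), by omega, by simp [rcPair, hr, show ¬ j + (n + 1) < n + 1 by omega]⟩

theorem exists_symBasis_eq_smul_of_le {n : ℕ} {p q : Fin n} (hpq : p ≤ q) :
    ∃ (j : Fin (triDim n)) (s : ℝ), s ≠ 0 ∧
      symBasis n j = s • (Matrix.single p q 1 + Matrix.single q p 1) := by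
  obtain ⟨j, hj, hr⟩ := exists_rcPair_eq n p q hpq q.2
  rcases eq_or_ne p q with rfl | hne
  · refine ⟨⟨j, hj⟩, 1 / 2, by norm_num, ?_⟩
    ext a b
    by_cases h : p = a ∧ p = b
    · obtain ⟨rfl, rfl⟩ := h
      simp [symBasis, hr]
      norm_num
    · have h' : ¬ (a = p ∧ b = p) := by grind
      simp [symBasis, hr, Fin.val_inj, h, h']
  · refine ⟨⟨j, hj⟩, Real.sqrt 2 / 2, by positivity, ?_⟩
    ext a b
    simp only [symBasis, hr, Fin.val_inj, hne, if_false, Matrix.of_apply, Matrix.smul_apply,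
      Matrix.add_apply, Matrix.single_apply, smul_eq_mul]
    grind

theorem exists_symBasis_eq_smul {n : ℕ} (p q : Fin n) :
    ∃ (j : Fin (triDim n)) (s : ℝ), s ≠ 0 ∧
      symBasis n j = s • (Matrix.single p q 1 + Matrix.single q p 1) := by
  rcases le_total p q with h | h
  · exact exists_symBasis_eq_smul_of_le h
  · simpa only [add_comm] using exists_symBasis_eq_smul_of_le h

theorem exists_Wmat_dotProduct {n : ℕ} (p q : Fin n) :
    ∃ (j : Fin (triDim n)) (s : ℝ), s ≠ 0 ∧ ∀ v : Fin (n * n) → ℝ,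
      ∑ k, Wmat n j k * v k = s * (v (finProdFinEquiv (p, q)) + v (finProdFinEquiv (q, p))) := by
  obtain ⟨j, s, hs, h⟩ := exists_symBasis_eq_smul p q
  refine ⟨j, s, hs, fun v => ?_⟩
  rw [← finProdFinEquiv.sum_comp, Fintype.sum_prod_type]
  simp only [Wmat, mvec, h, Matrix.of_apply, Equiv.symm_apply_apply, Matrix.smul_apply,
    Matrix.add_apply, Matrix.single_apply, smul_eq_mul, mul_add, add_mul, Finset.sum_add_distrib,
    ite_and, mul_ite, ite_mul, mul_one, mul_zero, zero_mul, Finset.sum_ite_eq, Finset.mem_univ,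
    if_true]
  ring

/-- If `A ⊗ₛ B = 0`, then the entries of `A ⊗ B` symmetrized in both
the row pair and the column pair vanish. -/
theorem symmetrized_entries_eq_zero {m n : ℕ} {A B : Matrix (Fin m) (Fin n) ℝ}
    (h : skron A B = 0) (i i' : Fin m) (k k' : Fin n) :
    A i k * B i' k' + A i k' * B i' k + A i' k * B i k' + A i' k' * B i k = 0 := by
  obtain ⟨a, s, hs, ha⟩ := exists_Wmat_dotProduct i i'
  obtain ⟨b, t, ht, hb⟩ := exists_Wmat_dotProduct k k'
  have hab : ∑ y, Wmat n b y * ∑ x, Wmat m a x * kron A B x y = 0 := by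
    simpa [skron, Matrix.mul_apply, mul_comm] using congrFun (congrFun h a) b
  rw [hb, ha, ha] at hab
  simp only [kron, Matrix.reindex_apply, Matrix.submatrix_apply, Equiv.symm_apply_apply,
    Matrix.kroneckerMap_apply] at hab
  refine (mul_eq_zero.mp ?_).resolve_left (mul_ne_zero hs ht)
  linear_combination hab

/-- `A ⊗ₛ B = 0` if and only if `A = 0` or `B = 0`. -/
theorem skron_eq_zero_iff (m n : ℕ) (A B : Matrix (Fin m) (Fin n) ℝ) :
    skron A B = 0 ↔ A = 0 ∨ B = 0 := by
  constructor
  · intro h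
    by_contra! hne
    obtain ⟨hA, hB⟩ := hne
    obtain ⟨p, q, hpq⟩ : ∃ p q, A p q ≠ 0 := by
      by_contra! hz
      exact hA (Matrix.ext hz)
    have key := symmetrized_entries_eq_zero h
    have cancel : ∀ x, A p q * x = 0 → x = 0 := fun x hx => (mul_eq_zero.mp hx).resolve_left hpq
    have hBpq : B p q = 0 := cancel _ (by linear_combination key p p q q / 4)
    have hrow : ∀ k, B p k = 0 := fun k =>
      cancel _ (by linear_combination key p p q k / 2 - A p k * hBpq)
    have hcol : ∀ i, B i q = 0 := fun i =>
      cancel _ (by linear_combination key p i q q / 2 - A i q * hBpq)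
    refine hB (Matrix.ext fun i k => cancel _ ?_)
    linear_combination key p i q k - A p k * hcol i - A i q * hrow k - A i k * hBpq
  · rintro (rfl | rfl) <;> simp [skron, kron]
end
end
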